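/- As x → ∞, log f(−x) ∼ −x²/2; precisely, lim_{x→∞} log f(−x) / (−x²/2) = 1, where f(x) = xΦ(x) + φ(x). -/

import Mathlib

open MeasureTheory ProbabilityTheory

/-- The probability density function `φ` of the standard normal distribution. -/
noncomputable def stdGaussPdf (x : ℝ) : ℝ := (Real.sqrt (2 * Real.pi))⁻¹ * Real.exp (-x ^ 2 / 2)

/-- The cumulative distribution function `Φ` of the standard normal distribution. -/
noncomputable def stdGaussCdf (x : ℝ) : ℝ := ((gaussianReal 0 1) (Set.Iic x)).toReal

/-- The expected-improvement function `f(x) = x Φ(x) + φ(x)`. -/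
noncomputable def eiF (x : ℝ) : ℝ := x * stdGaussCdf x + stdGaussPdf x

open Filter in
lemma tendsto_stdGaussPdf_atBot : Tendsto stdGaussPdf atBot (nhds 0) := by
  have h : Tendsto (fun x : ℝ => -x ^ 2 / 2) atBot atBot := by
    have h1 : Tendsto (fun x : ℝ => x ^ 2) atBot atTop := by
      simpa [sq] using (tendsto_id (α := ℝ) (x := atBot)).atBot_mul_atBot₀ tendsto_id
    exact (tendsto_neg_atTop_atBot.comp h1).atBot_div_const two_pos
  rw [← mul_zero (Real.sqrt (2 * Real.pi))⁻¹]
  exact (Real.tendsto_exp_atBot.comp h).const_mul _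

lemma stdGaussPdf_pos (x : ℝ) : 0 < stdGaussPdf x := by
  unfold stdGaussPdf
  positivity

lemma gaussianPDFReal_eq_stdGaussPdf : gaussianPDFReal 0 1 = stdGaussPdf := by
  ext x
  simp [gaussianPDFReal, stdGaussPdf]

lemma integrable_stdGaussPdf : Integrable stdGaussPdf :=
  gaussianPDFReal_eq_stdGaussPdf ▸ integrable_gaussianPDFReal 0 1

lemma integrable_id_mul_stdGaussPdf : Integrable (fun x => x * stdGaussPdf x) := by
  have h := (integrable_mul_exp_neg_mul_sq (b := 1 / 2) (by norm_num)).const_mul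
    (Real.sqrt (2 * Real.pi))⁻¹
  refine h.congr (.of_forall fun x => ?_)
  simp only [stdGaussPdf]
  rw [show -(1 / 2) * x ^ 2 = -x ^ 2 / 2 by ring]
  ring

lemma hasDerivAt_stdGaussPdf (x : ℝ) : HasDerivAt stdGaussPdf (-(x * stdGaussPdf x)) x := by
  have h : HasDerivAt (fun x : ℝ => -x ^ 2 / 2) (-x) x := by
    refine (((hasDerivAt_pow 2 x).neg).div_const 2).congr_deriv ?_
    norm_num
    ring
  refine (h.exp.const_mul (Real.sqrt (2 * Real.pi))⁻¹).congr_deriv ?_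
  simp only [stdGaussPdf]
  ring

lemma stdGaussCdf_eq_integral (a : ℝ) : stdGaussCdf a = ∫ t in Set.Iic a, stdGaussPdf t := by
  rw [stdGaussCdf, gaussianReal_apply_eq_integral 0 one_ne_zero, gaussianPDFReal_eq_stdGaussPdf,
    ENNReal.toReal_ofReal (integral_nonneg fun t => (stdGaussPdf_pos t).le)]

lemma integrable_sub_mul_stdGaussPdf (a : ℝ) : Integrable (fun t => (a - t) * stdGaussPdf t) := by
  simp only [sub_mul]
  exact (integrable_stdGaussPdf.const_mul a).sub integrable_id_mul_stdGaussPdf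

lemma eiF_eq_integral (a : ℝ) : eiF a = ∫ t in Set.Iic a, (a - t) * stdGaussPdf t := by
  have h := integral_Iic_of_hasDerivAt_of_tendsto' (a := a)
    (fun x _ => hasDerivAt_stdGaussPdf x) integrable_id_mul_stdGaussPdf.neg.integrableOn
    tendsto_stdGaussPdf_atBot
  rw [integral_neg, sub_zero] at h
  simp only [sub_mul]
  rw [integral_sub (integrable_stdGaussPdf.const_mul a).integrableOn
    integrable_id_mul_stdGaussPdf.integrableOn, integral_const_mul, ← stdGaussCdf_eq_integral,
    eiF, ← h, sub_eq_add_neg]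

lemma eiF_neg_le_stdGaussPdf {x : ℝ} (hx : 0 ≤ x) : eiF (-x) ≤ stdGaussPdf x := by
  have h : 0 ≤ x * stdGaussCdf (-x) := mul_nonneg hx ENNReal.toReal_nonneg
  have h' : stdGaussPdf (-x) = stdGaussPdf x := by simp [stdGaussPdf]
  rw [eiF, h']
  linarith

lemma stdGaussPdf_add_two_le_eiF_neg {x : ℝ} (hx : 0 ≤ x) : stdGaussPdf (x + 2) ≤ eiF (-x) := by
  have h_integrable := integrable_sub_mul_stdGaussPdf (-x)
  calc stdGaussPdf (x + 2)
      = ∫ _ in Set.Icc (-x - 2) (-x - 1), stdGaussPdf (x + 2) := by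
        simp; norm_num
    _ ≤ ∫ t in Set.Icc (-x - 2) (-x - 1), (-x - t) * stdGaussPdf t := by
        refine setIntegral_mono_on (integrableOn_const (by simp)) h_integrable.integrableOn
          measurableSet_Icc fun t ht => ?_
        have hle : stdGaussPdf (x + 2) ≤ stdGaussPdf t := by
          unfold stdGaussPdf
          gcongr ?_ * Real.exp (?_ / 2)
          nlinarith [ht.1, ht.2]
        nlinarith [ht.2, stdGaussPdf_pos t]
    _ ≤ ∫ t in Set.Iic (-x), (-x - t) * stdGaussPdf t := by
        refine setIntegral_mono_set h_integrable.integrableOn ?_ (.of_forall fun t ht => ?_)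
        · filter_upwards [ae_restrict_mem measurableSet_Iic] with t ht
          exact mul_nonneg (sub_nonneg.2 ht) (stdGaussPdf_pos t).le
        · exact ht.2.trans (by linarith)
    _ = eiF (-x) := (eiF_eq_integral _).symm

lemma log_stdGaussPdf (x : ℝ) :
    Real.log (stdGaussPdf x) = Real.log (Real.sqrt (2 * Real.pi))⁻¹ - x ^ 2 / 2 := by
  rw [stdGaussPdf, Real.log_mul (by positivity) (Real.exp_pos _).ne', Real.log_exp]
  ring

open Filter in
/-- Asymptotics of the expected-improvement function: `log f(−x) ∼ −x²/2` as `x → ∞`. -/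
theorem log_eiF_neg_asymptotic :
    Tendsto (fun x : ℝ => Real.log (eiF (-x)) / (-(x ^ 2) / 2)) atTop (nhds 1) := by
  set C := Real.log (Real.sqrt (2 * Real.pi))⁻¹ with hC
  have hinv : Tendsto (fun x : ℝ => x⁻¹) atTop (nhds 0) := tendsto_inv_atTop_zero
  have hlow : Tendsto (fun x : ℝ => 1 - 2 * C * x⁻¹ ^ 2) atTop (nhds 1) := by
    simpa using ((hinv.pow 2).const_mul (2 * C)).const_sub 1
  have hupp : Tendsto (fun x : ℝ => (1 + 2 * x⁻¹) ^ 2 - 2 * C * x⁻¹ ^ 2) atTop (nhds 1) := by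
    simpa using (((hinv.const_mul 2).const_add 1).pow 2).sub ((hinv.pow 2).const_mul (2 * C))
  refine tendsto_of_tendsto_of_tendsto_of_le_of_le' hlow hupp ?_ ?_
  all_goals
    filter_upwards [eventually_gt_atTop 0] with x hx
    have hneg : -(x ^ 2) / 2 < 0 := by have := pow_pos hx 2; linarith
    have hlb := stdGaussPdf_add_two_le_eiF_neg hx.le
  · have h := Real.log_le_log ((stdGaussPdf_pos _).trans_le hlb) (eiF_neg_le_stdGaussPdf hx.le)
    rw [log_stdGaussPdf, ← hC] at h
    rw [le_div_iff_of_neg hneg]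
    refine h.trans_eq ?_
    field_simp
    ring
  · have h := Real.log_le_log (stdGaussPdf_pos _) hlb
    rw [log_stdGaussPdf, ← hC] at h
    rw [div_le_iff_of_neg hneg]
    refine Eq.trans_le ?_ h
    field_simp
    ring
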